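/- arXiv:1908.09350 — 2 statements merged into one kernel-verified Lean document; each statement's English description precedes it below -/
import Mathlib

section
/- Let 1 ≤ i ≤ d = dim Δ, let Λ_{i−1}(Δ) be the set of nonnegative integer combinations of {∂_i(f) : f ∈ Δ_i}, and let X_{i−1}(Δ) = {σ ∈ C_{i−1}(Δ) : ∂_{i−1}(σ) ∈ Λ_{i−2}(Δ)}. Then the following are equivalent: (1) every σ ∈ X_{i−1}(Δ) is winnable; (2) crit_{i−1}(Δ) = 0; (3) Skel_i(Δ) is a spanning i-tree of Δ and H̃_{i−1}(Δ) = 0. -/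
open Finset Matrix

/-- A finite abstract simplicial complex on the vertex set `Fin n`: a collection of
finite subsets of `Fin n` (its faces) closed under taking subsets. -/
structure SComplex (n : ℕ) where
  faces : Finset (Finset (Fin n))
  down_closed : ∀ s ∈ faces, ∀ t ⊆ s, t ∈ faces

namespace SComplex

variable {n : ℕ} (Δ : SComplex n)

/-- The faces of cardinality `k`, i.e. the `(k-1)`-dimensional faces. -/
def Faces (k : ℕ) : Finset (Finset (Fin n)) :=
  Δ.faces.filter fun f => f.card = k

/-- The group of `(k-1)`-dimensional chains: formal `ℤ`-linear combinations of the
faces of cardinality `k`.  (So `Chain 0` plays the role of `C_{-1}(Δ) ≅ ℤ`, generated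
by the empty face, and `Chain (i+1)` is the group `C_i(Δ)` of `i`-dimensional chains.) -/
abbrev Chain (k : ℕ) : Type := {f // f ∈ Δ.Faces k} → ℤ

/-- The sign `(-1)^j` with which the subface `g` (obtained from `f` by deleting its
`j`-th smallest vertex) occurs in the boundary of `f`; `0` if `g` is not a
codimension-one subface of `f`. -/
def bcoef (f g : Finset (Fin n)) : ℤ :=
  if g ⊆ f ∧ f.card = g.card + 1 then
    ∑ v ∈ f \ g, (-1 : ℤ) ^ (f.filter (fun x => x < v)).card
  else 0

/-- The matrix (in the standard bases, with the standard orientation) of the boundary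
map from chains on faces of cardinality `k+1` to chains on faces of cardinality `k`. -/
def B (k : ℕ) : Matrix {f // f ∈ Δ.Faces k} {f // f ∈ Δ.Faces (k + 1)} ℤ :=
  fun g f => bcoef (f : Finset (Fin n)) (g : Finset (Fin n))

/-- The simplicial boundary map `∂_k : C_k(Δ) → C_{k-1}(Δ)` (standard orientation),
as a map `Chain (k+1) → Chain k`.  For `k = 0` this is the reduced boundary map into
`C_{-1}(Δ) ≅ ℤ`. -/
noncomputable def bdry (k : ℕ) : Δ.Chain (k + 1) →ₗ[ℤ] Δ.Chain k :=
  (Δ.B k).mulVecLin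

/-- The transpose `∂_kᵗ` of the boundary map. -/
noncomputable def tbdry (k : ℕ) : Δ.Chain k →ₗ[ℤ] Δ.Chain (k + 1) :=
  ((Δ.B k)ᵀ).mulVecLin

/-- The matrix of the `i`-th (up-down combinatorial) Laplacian. -/
def LapM (i : ℕ) : Matrix {f // f ∈ Δ.Faces (i + 1)} {f // f ∈ Δ.Faces (i + 1)} ℤ :=
  Δ.B (i + 1) * (Δ.B (i + 1))ᵀ

/-- The `i`-th Laplacian `L_i = ∂_{i+1} ∘ ∂_{i+1}ᵗ` on `i`-dimensional chains. -/
noncomputable def Lap (i : ℕ) : Δ.Chain (i + 1) →ₗ[ℤ] Δ.Chain (i + 1) :=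
  (Δ.LapM i).mulVecLin

/-- A chain is effective if all of its coefficients are nonnegative. -/
def Effective {k : ℕ} (σ : Δ.Chain k) : Prop := ∀ f, 0 ≤ σ f

/-- `σ·h = Σ_f σ(f)h(f)`. -/
def dot {k : ℕ} (σ h : Δ.Chain k) : ℤ := ∑ f, σ f * h f

/-- The `i`-th nonnegative kernel `ker⁺L_i`: effective `i`-chains in `ker L_i`. -/
def kerPlus (i : ℕ) : Set (Δ.Chain (i + 1)) :=
  {τ | Δ.Lap i τ = 0 ∧ Δ.Effective τ}

/-- Two `i`-chains are linearly equivalent if their difference lies in `im L_i`. -/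
def LinEquiv (i : ℕ) (σ σ' : Δ.Chain (i + 1)) : Prop :=
  σ' - σ ∈ LinearMap.range (Δ.Lap i)

/-- An `i`-chain is winnable if it is linearly equivalent to an effective `i`-chain. -/
def Winnable (i : ℕ) (σ : Δ.Chain (i + 1)) : Prop :=
  ∃ σ', Δ.Effective σ' ∧ Δ.LinEquiv i σ σ'

/-- The Hilbert basis of `ker⁺L_i`: its nonzero elements that are not the sum of two
nonzero elements of `ker⁺L_i`. -/
def hilbBasis (i : ℕ) : Set (Δ.Chain (i + 1)) :=
  {τ | τ ∈ Δ.kerPlus i ∧ τ ≠ 0 ∧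
    ¬ ∃ a ∈ Δ.kerPlus i, ∃ b ∈ Δ.kerPlus i, a ≠ 0 ∧ b ≠ 0 ∧ τ = a + b}

/-- The cycles among the chains on faces of cardinality `k`: the kernel of the
(reduced) boundary map `∂_{k-1}`.  For `k = 0` (the `(-1)`-chains, where the boundary
map is zero) every chain is a cycle. -/
noncomputable def cycles : (k : ℕ) → Submodule ℤ (Δ.Chain k)
  | 0 => ⊤
  | (k + 1) => LinearMap.ker (Δ.bdry k)

/-- The image of the `i`-th Laplacian, viewed inside the `i`-cycles. -/
noncomputable def critSub (i : ℕ) : Submodule ℤ ↥(Δ.cycles (i + 1)) :=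
  Submodule.comap (Δ.cycles (i + 1)).subtype (LinearMap.range (Δ.Lap i))

/-- The `i`-th critical group `crit_i(Δ) = ker ∂_i / im L_i`. -/
noncomputable abbrev Crit (i : ℕ) : Type :=
  ↥(Δ.cycles (i + 1)) ⧸ Δ.critSub i

/-- The image of the boundary map `∂_k`, viewed inside the cycles `cycles k`. -/
noncomputable def bdrySub (k : ℕ) : Submodule ℤ ↥(Δ.cycles k) :=
  Submodule.comap (Δ.cycles k).subtype (LinearMap.range (Δ.bdry k))

/-- The reduced homology group `H̃_{k-1}(Δ) = ker ∂_{k-1} / im ∂_k` (so the `i`-th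
reduced homology group of `Δ` is `RedHomologyAt (i+1)`). -/
noncomputable abbrev RedHomologyAt (k : ℕ) : Type :=
  ↥(Δ.cycles k) ⧸ Δ.bdrySub k

/-- The orthogonal complement `(ker L_i)^⊥` of `ker L_i` in the `i`-chains. -/
def kerPerp (i : ℕ) : Submodule ℤ (Δ.Chain (i + 1)) where
  carrier := {σ | ∀ τ ∈ LinearMap.ker (Δ.Lap i), Δ.dot σ τ = 0}
  add_mem' := by
    intro a b ha hb τ hτ
    have h : Δ.dot (a + b) τ = Δ.dot a τ + Δ.dot b τ := by
      simp [dot, Pi.add_apply, add_mul, Finset.sum_add_distrib]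
    rw [h, ha τ hτ, hb τ hτ, add_zero]
  zero_mem' := by
    intro τ hτ
    simp [dot]
  smul_mem' := by
    intro c a ha τ hτ
    have h : Δ.dot (c • a) τ = c * Δ.dot a τ := by
      simp [dot, Pi.smul_apply, Finset.mul_sum, mul_assoc]
    rw [h, ha τ hτ, mul_zero]

/-! ### Pseudomanifolds -/

/-- `Δ` is a pseudomanifold of dimension `d` (the facets are the faces of
cardinality `d+1`): it is pure, non-branching, and strongly connected. -/
def IsPseudomanifold (d : ℕ) : Prop :=
  (∀ f ∈ Δ.faces, ∃ g ∈ Δ.Faces (d + 1), f ⊆ g) ∧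
  (∀ g ∈ Δ.Faces d, ((Δ.Faces (d + 1)).filter fun f => g ⊆ f).card ≤ 2) ∧
  (∀ f ∈ Δ.Faces (d + 1), ∀ f' ∈ Δ.Faces (d + 1),
    Relation.ReflTransGen
      (fun a b => a ∈ Δ.Faces (d + 1) ∧ b ∈ Δ.Faces (d + 1) ∧ (a ∩ b).card = d) f f')

/-- The boundary `∂Δ` of a `d`-dimensional pseudomanifold: the `(d-1)`-faces contained
in exactly one facet. -/
def pmBoundary (d : ℕ) : Finset (Finset (Fin n)) :=
  (Δ.Faces d).filter fun g => ((Δ.Faces (d + 1)).filter fun f => g ⊆ f).card = 1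

/-- A pseudomanifold orientation for a `d`-dimensional pseudomanifold: a top chain
`γ` with all coefficients `±1` whose boundary is supported on `∂Δ`. -/
noncomputable def IsOrientation (d : ℕ) (γ : Δ.Chain (d + 1)) : Prop :=
  (∀ f, γ f = 1 ∨ γ f = -1) ∧
  (∀ g : {f // f ∈ Δ.Faces d},
    (g : Finset (Fin n)) ∉ Δ.pmBoundary d → Δ.bdry d γ g = 0)

/-- `γ_j` as a top-dimensional chain, for a vertex `j` of the `γ`-incidence graph:
the extra vertex `γ_0 = 0` is encoded by `none`, and the oriented facet `γ_f` by
`some f`. -/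
noncomputable def gammaInd (D : ℕ) (γ : Δ.Chain (D + 1)) :
    Option {f // f ∈ Δ.Faces (D + 1)} → Δ.Chain (D + 1)
  | none => 0
  | some f => Pi.single f (γ f)

/-- The edge of the `γ`-incidence graph corresponding to the `(D-1)`-dimensional face
`σ` goes from the vertex `a` to the vertex `b`: this means `∂ᵗ(σ) = γ_b - γ_a`. -/
noncomputable def edgeFromTo (D : ℕ) (γ : Δ.Chain (D + 1)) (σ : {f // f ∈ Δ.Faces D})
    (a b : Option {f // f ∈ Δ.Faces (D + 1)}) : Prop :=
  Δ.tbdry D (Pi.single σ 1) = Δ.gammaInd D γ b - Δ.gammaInd D γ a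

/-- `τ` is the incidence vector of a simple directed cycle of the `γ`-incidence graph
`Γ(Δ,γ)`: there is a closed directed walk with pairwise distinct vertices and pairwise
distinct edges whose edge labels sum to `τ`. -/
noncomputable def IsCycleVector (D : ℕ) (γ : Δ.Chain (D + 1)) (τ : Δ.Chain D) : Prop :=
  ∃ (k : ℕ) (hk : 0 < k) (v : Fin k → Option {f // f ∈ Δ.Faces (D + 1)})
    (e : Fin k → {f // f ∈ Δ.Faces D}),
    Function.Injective v ∧ Function.Injective e ∧
    (∀ t : Fin k, Δ.edgeFromTo D γ (e t) (v t) (v ⟨(t.1 + 1) % k, Nat.mod_lt _ hk⟩)) ∧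
    τ = ∑ t : Fin k, Pi.single (e t) (1 : ℤ)

/-! ### Spanning forests -/

/-- The chains supported on a set `F` of faces. -/
def suppIn (k : ℕ) (F : Finset (Finset (Fin n))) : Submodule ℤ (Δ.Chain k) where
  carrier := {σ | ∀ f : {f // f ∈ Δ.Faces k}, (f : Finset (Fin n)) ∉ F → σ f = 0}
  add_mem' := by
    intro a b ha hb f hf
    simp [Pi.add_apply, ha f hf, hb f hf]
  zero_mem' := by intro f hf; rfl
  smul_mem' := by
    intro c a ha f hf
    simp [Pi.smul_apply, ha f hf]

/-- The reduced homology group `H̃_{i-1}(Υ)` of the subcomplex `Υ` with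
`Skel_{i-1}(Υ) = Skel_{i-1}(Δ)` and with set of `i`-faces `F`: namely
`ker ∂_{i-1} / ∂_i(chains supported on F)`. -/
noncomputable abbrev forestHom (i : ℕ) (F : Finset (Finset (Fin n))) : Type :=
  ↥(Δ.cycles i) ⧸ Submodule.comap (Δ.cycles i).subtype
      (Submodule.map (Δ.bdry i) (Δ.suppIn (i + 1) F))

/-- `F ⊆ Δ_i` encodes a spanning `i`-forest of `Δ`: the `i`-dimensional subcomplex
`Υ` with `Skel_{i-1}(Υ) = Skel_{i-1}(Δ)` and with `i`-faces `F`, subject to: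
`H̃_i(Υ) = 0`; `β̃_{i-1}(Υ) = β̃_{i-1}(Δ)`; and `|Υ_i| = |Δ_i| - β̃_i(Skel_i(Δ))`
(note `H̃_i(Skel_i(Δ)) = ker ∂_i` since `Skel_i(Δ)` has no `(i+1)`-faces). -/
noncomputable def IsSpanningForest (i : ℕ) (F : Finset (Finset (Fin n))) : Prop :=
  F ⊆ Δ.Faces (i + 1) ∧
  (∀ σ ∈ Δ.suppIn (i + 1) F, Δ.bdry i σ = 0 → σ = 0) ∧
  Module.finrank ℤ (Δ.forestHom i F) = Module.finrank ℤ (Δ.RedHomologyAt i) ∧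
  F.card = (Δ.Faces (i + 1)).card - Module.finrank ℤ ↥(Δ.cycles (i + 1))

open scoped Classical in
/-- The `i`-forest number `τ_i(Δ) = Σ_Υ |T(H̃_{i-1}(Υ))|²`, the sum over all spanning
`i`-forests of `Δ`. -/
noncomputable def forestNumber (i : ℕ) : ℕ :=
  ∑ F ∈ (Δ.Faces (i + 1)).powerset.filter (fun F => Δ.IsSpanningForest i F),
    (Nat.card ↥(Submodule.torsion ℤ (Δ.forestHom i F))) ^ 2

/-- Restriction of chains to the coordinates indexed by a subset `Θ` of the faces
(i.e. setting the remaining coordinates to `0`). -/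
noncomputable def restrictTo (k : ℕ) (Θ : Finset (Finset (Fin n)))
    (hΘ : Θ ⊆ Δ.Faces k) : Δ.Chain k →ₗ[ℤ] ({f // f ∈ Θ} → ℤ) where
  toFun σ := fun a => σ ⟨a.1, hΘ a.2⟩
  map_add' := by intros; rfl
  map_smul' := by intros; rfl

/-- The reduced Laplacian: the square submatrix of `L_i` consisting of the rows
and columns indexed by `Θ`, as a linear map `ℤΘ → ℤΘ`. -/
noncomputable def redLap (i : ℕ) (Θ : Finset (Finset (Fin n)))
    (hΘ : Θ ⊆ Δ.Faces (i + 1)) : ({f // f ∈ Θ} → ℤ) →ₗ[ℤ] ({f // f ∈ Θ} → ℤ) :=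
  (Matrix.of fun a b : {f // f ∈ Θ} =>
    Δ.LapM i ⟨a.1, hΘ a.2⟩ ⟨b.1, hΘ b.2⟩).mulVecLin

end SComplex

namespace SComplex

variable {n : ℕ}

lemma bcoef_erase {f : Finset (Fin n)} {v : Fin n} (hv : v ∈ f) :
    bcoef f (f.erase v) = (-1) ^ (f.filter (fun x => x < v)).card := by
  have h : f \ f.erase v = {v} := by
    ext x
    simp only [mem_sdiff, mem_erase, mem_singleton]
    grind
  rw [bcoef, if_pos ⟨erase_subset v f, (card_erase_add_one hv).symm⟩, h, sum_singleton]

lemma bcoef_eq_zero {f g : Finset (Fin n)} (h : ∀ v ∈ f, g ≠ f.erase v) : bcoef f g = 0 := by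
  rw [bcoef, if_neg]
  rintro ⟨hs, hc⟩
  obtain ⟨v, hv⟩ : ∃ v, f \ g = {v} := by
    rw [← card_eq_one, card_sdiff_of_subset hs]
    omega
  have hvf : v ∈ f \ g := by simp [hv]
  refine h v (mem_sdiff.1 hvf).1 ?_
  rw [erase_eq, ← hv, Finset.sdiff_sdiff_eq_self hs]

variable (Δ : SComplex n)

lemma mem_Faces {k : ℕ} {f : Finset (Fin n)} : f ∈ Δ.Faces k ↔ f ∈ Δ.faces ∧ f.card = k := by
  simp [Faces]

lemma erase_mem_Faces {k : ℕ} {f : Finset (Fin n)} (hf : f ∈ Δ.Faces (k + 1)) {v : Fin n}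
    (hv : v ∈ f) : f.erase v ∈ Δ.Faces k := by
  rw [mem_Faces] at hf ⊢
  refine ⟨Δ.down_closed f hf.1 _ (erase_subset v f), ?_⟩
  rw [card_erase_of_mem hv, hf.2, Nat.add_sub_cancel]

/-- A sum weighted by the incidences with `f` runs over the vertices of `f`. -/
lemma sum_mul_bcoef {k : ℕ} {f : Finset (Fin n)} (hf : f ∈ Δ.Faces (k + 1))
    (F : Finset (Fin n) → ℤ) :
    ∑ g : {g // g ∈ Δ.Faces k}, F g * bcoef f g =
      ∑ v ∈ f, F (f.erase v) * (-1) ^ (f.filter (fun x => x < v)).card := by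
  rw [Finset.sum_coe_sort (Δ.Faces k) (fun g => F g * bcoef f g)]
  have hsub : f.image (fun v => f.erase v) ⊆ Δ.Faces k := by
    intro g hg
    obtain ⟨v, hv, rfl⟩ := mem_image.1 hg
    exact Δ.erase_mem_Faces hf hv
  rw [← Finset.sum_subset hsub, Finset.sum_image]
  · exact sum_congr rfl fun v hv => by rw [bcoef_erase hv]
  · exact erase_injOn f
  · intro g _ hg
    rw [bcoef_eq_zero, mul_zero]
    rintro v hv rfl
    exact hg (mem_image_of_mem _ hv)

lemma bcoef_erase_erase_cancel {f : Finset (Fin n)} {u v : Fin n} (hu : u ∈ f) (hv : v ∈ f)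
    (huv : u < v) :
    bcoef (f.erase u) ((f.erase u).erase v) * (-1) ^ (f.filter (fun x => x < u)).card +
      bcoef (f.erase v) ((f.erase v).erase u) * (-1) ^ (f.filter (fun x => x < v)).card = 0 := by
  rw [bcoef_erase (mem_erase.2 ⟨huv.ne', hv⟩), bcoef_erase (mem_erase.2 ⟨huv.ne, hu⟩)]
  have h₁ : (f.erase v).filter (fun x => x < u) = f.filter (fun x => x < u) := by
    ext x
    simp only [mem_filter, mem_erase]
    grind
  have h₂ : ((f.erase u).filter (fun x => x < v)).card + 1 =
      (f.filter (fun x => x < v)).card := by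
    rw [filter_erase, card_erase_add_one]
    simp [hu, huv]
  rw [h₁, ← h₂]
  ring

lemma B_mul_B (k : ℕ) : Δ.B k * Δ.B (k + 1) = 0 := by
  ext ⟨h, hh⟩ ⟨f, hf⟩
  rw [Matrix.mul_apply]
  simp only [B, Matrix.zero_apply]
  rw [Δ.sum_mul_bcoef hf (fun g => bcoef g h)]
  have hvanish : ∀ v ∈ f, (h ⊆ f → v ∉ f \ h) →
      bcoef (f.erase v) h * (-1) ^ (f.filter (fun x => x < v)).card = 0 := by
    intro v hv hvh
    rw [bcoef, if_neg, zero_mul]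
    rintro ⟨hs, -⟩
    refine hvh (hs.trans (erase_subset v f)) (mem_sdiff.2 ⟨hv, fun hm => ?_⟩)
    exact notMem_erase v f (hs hm)
  by_cases hs : h ⊆ f
  · obtain ⟨u, v, huv, hset⟩ : ∃ u v, u ≠ v ∧ f \ h = {u, v} := by
      rw [← card_eq_two, card_sdiff_of_subset hs, ((Δ.mem_Faces).1 hf).2, ((Δ.mem_Faces).1 hh).2]
      omega
    have hu : u ∈ f := (mem_sdiff.1 (by simp [hset] : u ∈ f \ h)).1
    have hv : v ∈ f := (mem_sdiff.1 (by simp [hset] : v ∈ f \ h)).1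
    have e₁ : h = (f.erase u).erase v := by
      rw [← Finset.sdiff_sdiff_eq_self hs, hset]
      ext x
      simp only [mem_sdiff, mem_insert, mem_singleton, mem_erase]
      tauto
    have e₂ : h = (f.erase v).erase u := by rw [e₁, erase_right_comm]
    rw [← Finset.sum_subset (sdiff_subset : f \ h ⊆ f) fun w hw hwh =>
      hvanish w hw fun _ => hwh, hset, sum_pair huv]
    rcases huv.lt_or_gt with hlt | hlt
    · have := bcoef_erase_erase_cancel hu hv hlt
      rwa [← e₁, ← e₂] at this
    · have := bcoef_erase_erase_cancel hv hu hlt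
      rwa [← e₁, ← e₂, add_comm] at this
  · exact sum_eq_zero fun v hv => hvanish v hv fun h' => absurd h' hs

lemma bdry_bdry (k : ℕ) (σ : Δ.Chain (k + 2)) : Δ.bdry k (Δ.bdry (k + 1) σ) = 0 := by
  simp [bdry, Matrix.mulVec_mulVec, B_mul_B]

lemma Lap_apply (k : ℕ) (σ : Δ.Chain (k + 1)) :
    Δ.Lap k σ = Δ.bdry (k + 1) (Δ.tbdry (k + 1) σ) := by
  simp [Lap, LapM, bdry, tbdry]

lemma bdry_Lap (k : ℕ) (σ : Δ.Chain (k + 1)) : Δ.bdry k (Δ.Lap k σ) = 0 := by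
  rw [Lap_apply, bdry_bdry]

/-- Maximality of the sum of all vertices but the smallest one makes every term of the
boundary at the opposite face nonnegative. -/
lemma eq_zero_of_effective_of_bdry_eq_zero {k : ℕ} {σ : Δ.Chain (k + 1)} (hσ : Δ.Effective σ)
    (h : Δ.bdry k σ = 0) : σ = 0 := by
  by_contra hne
  have hcard (f : {f // f ∈ Δ.Faces (k + 1)}) : f.1.Nonempty := by
    rw [← card_pos, ((Δ.mem_Faces).1 f.2).2]
    omega
  let w : {f // f ∈ Δ.Faces (k + 1)} → ℕ :=
    fun f => ∑ x ∈ f.1.erase (f.1.min' (hcard f)), (x : ℕ)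
  obtain ⟨f₀, hf₀⟩ := Function.ne_iff.1 hne
  obtain ⟨f, hf, hmax⟩ := (univ.filter fun f => σ f ≠ 0).exists_max_image w
    ⟨f₀, by simpa using hf₀⟩
  simp only [mem_filter, mem_univ, true_and] at hf hmax
  set m := f.1.min' (hcard f) with hm
  have hmf : m ∈ f.1 := min'_mem _ _
  have hcoef : bcoef f.1 (f.1.erase m) = 1 := by
    rw [bcoef_erase hmf, filter_false_of_mem, card_empty, pow_zero]
    intro x hx
    exact not_lt.2 (min'_le _ _ hx)
  have hsum : ∑ f', bcoef f'.1 (f.1.erase m) * σ f' = 0 :=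
    congrFun h ⟨f.1.erase m, Δ.erase_mem_Faces f.2 hmf⟩
  have hterm : ∀ f' ∈ univ, 0 ≤ bcoef (f' : {f // f ∈ Δ.Faces (k + 1)}).1 (f.1.erase m) * σ f' := by
    intro f' _
    by_cases hσ' : σ f' = 0
    · simp [hσ']
    by_cases hex : ∃ v ∈ f'.1, f.1.erase m = f'.1.erase v
    · obtain ⟨v, hv, he⟩ := hex
      have hvm : v = f'.1.min' (hcard f') := by
        by_contra hvm
        have hle := hmax f' hσ'
        set m' := f'.1.min' (hcard f') with hm'
        have hlt : m' < v := lt_of_le_of_ne (min'_le _ _ hv) (Ne.symm hvm)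
        have h₁ : w f = ∑ x ∈ f'.1.erase v, (x : ℕ) := by rw [← he]
        have h₂ := Finset.sum_erase_add f'.1 (fun x => (x : ℕ)) hv
        have h₃ := Finset.sum_erase_add f'.1 (fun x => (x : ℕ)) (min'_mem f'.1 (hcard f'))
        have h₄ : w f' = ∑ x ∈ f'.1.erase m', (x : ℕ) := rfl
        have h₅ : (m' : ℕ) < v := hlt
        rw [← hm'] at h₃
        omega
      rw [he, bcoef_erase hv, filter_false_of_mem, card_empty, pow_zero, one_mul]
      · exact hσ f'
      · intro x hx
        rw [hvm]
        exact not_lt.2 (min'_le _ _ hx)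
    · push Not at hex
      rw [bcoef_eq_zero hex, zero_mul]
  have := (Finset.sum_eq_zero_iff_of_nonneg hterm).1 hsum f (mem_univ f)
  rw [hcoef, one_mul] at this
  exact hf this

lemma bdry_single_ne_zero {k : ℕ} (f : {f // f ∈ Δ.Faces (k + 1)}) :
    Δ.bdry k (Pi.single f 1) ≠ 0 := by
  intro h
  have heff : Δ.Effective (Pi.single f 1 : Δ.Chain (k + 1)) := fun g => by
    by_cases hg : g = f
    · subst hg; simp
    · simp [hg]
  have := congrFun (Δ.eq_zero_of_effective_of_bdry_eq_zero heff h) f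
  simp at this

lemma forall_crit_eq_zero_iff (k : ℕ) :
    (∀ x : Δ.Crit k, x = 0) ↔
      LinearMap.ker (Δ.bdry k) ≤ LinearMap.range (Δ.Lap k) := by
  constructor
  · intro h σ hσ
    exact (Submodule.Quotient.mk_eq_zero (x := (⟨σ, hσ⟩ : Δ.cycles (k + 1))) _).1 (h _)
  · intro h x
    obtain ⟨σ, rfl⟩ := Submodule.Quotient.mk_surjective _ x
    exact (Submodule.Quotient.mk_eq_zero _).2 (h σ.2)

lemma forall_redHomologyAt_eq_zero_iff (k : ℕ) :
    (∀ x : Δ.RedHomologyAt (k + 1), x = 0) ↔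
      LinearMap.ker (Δ.bdry k) ≤ LinearMap.range (Δ.bdry (k + 1)) := by
  constructor
  · intro h σ hσ
    exact (Submodule.Quotient.mk_eq_zero (x := (⟨σ, hσ⟩ : Δ.cycles (k + 1))) _).1 (h _)
  · intro h x
    obtain ⟨σ, rfl⟩ := Submodule.Quotient.mk_surjective _ x
    exact (Submodule.Quotient.mk_eq_zero _).2 (h σ.2)

lemma suppIn_Faces (k : ℕ) : Δ.suppIn k (Δ.Faces k) = ⊤ :=
  eq_top_iff.2 fun _ _ f hf => absurd f.2 hf

lemma isSpanningForest_Faces_iff (i : ℕ) :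
    Δ.IsSpanningForest i (Δ.Faces (i + 1)) ↔ LinearMap.ker (Δ.bdry i) = ⊥ := by
  constructor
  · rintro ⟨-, h, -⟩
    exact LinearMap.ker_eq_bot'.2 fun σ => h σ (by rw [suppIn_Faces]; trivial)
  · intro h
    refine ⟨Subset.rfl, fun σ _ => LinearMap.ker_eq_bot'.1 h σ, ?_, ?_⟩
    · refine (Submodule.quotEquivOfEq _ _ ?_).finrank_eq
      rw [suppIn_Faces, Submodule.map_top, bdrySub]
    · have : Δ.cycles (i + 1) = ⊥ := h
      rw [this, finrank_bot, Nat.sub_zero]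

end SComplex

/-- If `M Mᵀ` and `M` have the same image, the integral lattice splits orthogonally as
`ker M ⊕ im Mᵀ`, so each standard basis vector lies in one of the two summands. -/
lemma Matrix.ker_mulVecLin_eq_bot_of_range_le {m p : Type*} [Fintype m] [Fintype p]
    [DecidableEq p] (M : Matrix m p ℤ)
    (hM : LinearMap.range M.mulVecLin ≤ LinearMap.range (M * Mᵀ).mulVecLin)
    (hcol : ∀ f, M *ᵥ Pi.single f 1 ≠ 0) : LinearMap.ker M.mulVecLin = ⊥ := by
  have orth : ∀ (a : p → ℤ) (y : m → ℤ), M *ᵥ a = 0 → a ⬝ᵥ (Mᵀ *ᵥ y) = 0 := by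
    intro a y ha
    rw [dotProduct_mulVec, vecMul_transpose, ha, zero_dotProduct]
  refine LinearMap.ker_eq_bot'.2 fun a ha => ?_
  rw [mulVecLin_apply] at ha
  ext f
  obtain ⟨y, hy⟩ := hM ⟨Pi.single f 1, rfl⟩
  simp only [mulVecLin_apply, ← mulVec_mulVec] at hy
  set b := Mᵀ *ᵥ y with hb
  have hker : M *ᵥ (Pi.single f 1 - b) = 0 := by rw [mulVec_sub, hy, sub_self]
  have hdot : (Pi.single f 1 - b) ⬝ᵥ b = 0 := orth _ y hker
  rw [sub_dotProduct, single_dotProduct, one_mul, dotProduct] at hdot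
  have hbf : b f ≠ 0 := by
    intro h0
    have hb0 : b = 0 := by
      rw [← dotProduct_self_eq_zero, dotProduct]
      omega
    rw [hb0, mulVec_zero] at hy
    exact hcol f hy.symm
  have hle : b f * b f ≤ b f := by
    have := Finset.single_le_sum (f := fun i => b i * b i) (fun i _ => mul_self_nonneg (b i))
      (mem_univ f)
    omega
  have hbf1 : b f = 1 := by
    have h₁ : 0 < b f := lt_of_lt_of_le (mul_self_pos.2 hbf) hle
    nlinarith
  have hbe : Pi.single f 1 - b = 0 := by
    rw [← dotProduct_self_eq_zero, dotProduct_sub, dotProduct_single, mul_one]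
    rw [sub_dotProduct, single_dotProduct, one_mul, dotProduct]
    simp only [Pi.sub_apply, Pi.single_eq_same]
    omega
  have := orth a y ha
  rw [← hb, ← sub_eq_zero.1 hbe, dotProduct_single, mul_one] at this
  exact this

/-- An injective integer matrix whose image is the kernel of an integer matrix has a
surjective transpose. -/
lemma Matrix.transpose_mulVec_surjective_of_range_eq_ker {l m p : Type*} [Fintype l] [Fintype m]
    [Fintype p] [DecidableEq m] [DecidableEq p] (N : Matrix l m ℤ) (M : Matrix m p ℤ)
    (hM : LinearMap.ker M.mulVecLin = ⊥)
    (h : LinearMap.range M.mulVecLin = LinearMap.ker N.mulVecLin) (x : p → ℤ) :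
    ∃ y, Mᵀ *ᵥ y = x := by
  obtain ⟨s, hs⟩ : ∃ s : LinearMap.range N.mulVecLin →ₗ[ℤ] (m → ℤ),
      N.mulVecLin.rangeRestrict ∘ₗ s = LinearMap.id :=
    Module.projective_lifting_property _ _ N.mulVecLin.surjective_rangeRestrict
  have hex : Function.Exact M.mulVecLin N.mulVecLin.rangeRestrict := by
    rw [LinearMap.exact_iff, LinearMap.ker_rangeRestrict, h]
  obtain ⟨r, hr⟩ : ∃ r : (m → ℤ) →ₗ[ℤ] (p → ℤ), r ∘ₗ M.mulVecLin = LinearMap.id :=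
    ((hex.split_tfae'.out 0 1 rfl rfl).1 ⟨LinearMap.ker_eq_bot.1 hM, s, hs⟩).2
  have hmul : LinearMap.toMatrix' r * M = 1 := by
    rw [← LinearMap.toMatrix'_toLin' M, ← LinearMap.toMatrix'_comp, Matrix.toLin'_apply', hr,
      LinearMap.toMatrix'_id]
  refine ⟨(LinearMap.toMatrix' r)ᵀ *ᵥ x, ?_⟩
  rw [mulVec_mulVec, ← transpose_mul, hmul, transpose_one, one_mulVec]

namespace SComplex

variable {n : ℕ} (Δ : SComplex n)

lemma range_bdry_le_ker (k : ℕ) :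
    LinearMap.range (Δ.bdry (k + 1)) ≤ LinearMap.ker (Δ.bdry k) := by
  rintro _ ⟨σ, rfl⟩
  exact Δ.bdry_bdry k σ

lemma range_Lap_le_range_bdry (k : ℕ) :
    LinearMap.range (Δ.Lap k) ≤ LinearMap.range (Δ.bdry (k + 1)) := by
  rintro _ ⟨σ, rfl⟩
  exact ⟨_, (Δ.Lap_apply k σ).symm⟩

lemma ker_bdry_le_range_Lap_iff (k : ℕ) :
    LinearMap.ker (Δ.bdry k) ≤ LinearMap.range (Δ.Lap k) ↔
      LinearMap.ker (Δ.bdry (k + 1)) = ⊥ ∧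
        LinearMap.ker (Δ.bdry k) ≤ LinearMap.range (Δ.bdry (k + 1)) := by
  constructor
  · intro h
    refine ⟨?_, h.trans (Δ.range_Lap_le_range_bdry k)⟩
    exact (Δ.B (k + 1)).ker_mulVecLin_eq_bot_of_range_le ((Δ.range_bdry_le_ker k).trans h)
      fun f => Δ.bdry_single_ne_zero f
  · rintro ⟨hinj, hex⟩ σ hσ
    obtain ⟨x, rfl⟩ := hex hσ
    obtain ⟨y, rfl⟩ := (Δ.B k).transpose_mulVec_surjective_of_range_eq_ker (Δ.B (k + 1)) hinj
      (le_antisymm (Δ.range_bdry_le_ker k) hex) x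
    exact ⟨y, Δ.Lap_apply k y⟩

lemma sum_smul_bdry_single {k : ℕ} (c : Δ.Chain (k + 1)) :
    ∑ g : {f // f ∈ Δ.Faces (k + 1)}, c g • Δ.bdry k (Pi.single g 1) = Δ.bdry k c := by
  simp_rw [← map_smul, ← map_sum]
  congr 1
  ext g
  simp [Finset.sum_apply, Pi.single_apply]

lemma forall_winnable_iff (k : ℕ) :
    (∀ σ : Δ.Chain (k + 1),
      (∃ c : {f // f ∈ Δ.Faces (k + 1)} → ℕ,
        Δ.bdry k σ = ∑ g, (c g : ℤ) • Δ.bdry k (Pi.single g 1)) → Δ.Winnable k σ) ↔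
      LinearMap.ker (Δ.bdry k) ≤ LinearMap.range (Δ.Lap k) := by
  constructor
  · intro h σ hσ
    rw [LinearMap.mem_ker] at hσ
    obtain ⟨σ', heff, ρ, hρ⟩ := h σ ⟨0, by simp [hσ]⟩
    have hcyc : Δ.bdry k σ' = 0 := by
      rw [← sub_add_cancel σ' σ, ← hρ, map_add, bdry_Lap, hσ, add_zero]
    rw [Δ.eq_zero_of_effective_of_bdry_eq_zero heff hcyc, zero_sub] at hρ
    exact ⟨-ρ, by rw [map_neg, hρ, neg_neg]⟩
  · rintro h σ ⟨c, hc⟩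
    refine ⟨fun g => c g, fun g => Int.natCast_nonneg _, h ?_⟩
    rw [LinearMap.mem_ker, map_sub, hc, sub_eq_zero]
    convert (Δ.sum_smul_bdry_single fun g => (c g : ℤ)).symm

end SComplex

/-- (Stated with `j + 1` in place of the paper's `i`, so that
`1 ≤ i` holds automatically; `i ≤ dim Δ` is the hypothesis `hdim`.)
`Λ_{i-1}(Δ)` is the set of nonnegative integer combinations of `{∂_i(f) : f ∈ Δ_i}`
and `X_{i-1}(Δ) = {σ ∈ C_{i-1}(Δ) : ∂_{i-1}(σ) ∈ Λ_{i-2}(Δ)}`.  The following are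
equivalent: (1) every `σ ∈ X_{i-1}(Δ)` is winnable; (2) `crit_{i-1}(Δ) = 0`;
(3) `Skel_i(Δ)` is a spanning `i`-tree of `Δ` and `H̃_{i-1}(Δ) = 0`. -/
theorem staco_characterization {n : ℕ} (Δ : SComplex n) (j : ℕ)
    (hdim : (Δ.Faces (j + 2)).Nonempty) :
    ((∀ σ : Δ.Chain (j + 1),
        (∃ c : {f // f ∈ Δ.Faces (j + 1)} → ℕ,
          Δ.bdry j σ = ∑ g, (c g : ℤ) • Δ.bdry j (Pi.single g 1)) →
        Δ.Winnable j σ) ↔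
      (∀ x : Δ.Crit j, x = 0)) ∧
    ((∀ x : Δ.Crit j, x = 0) ↔
      (Δ.IsSpanningForest (j + 1) (Δ.Faces (j + 2)) ∧
        Module.finrank ℤ (Δ.RedHomologyAt (j + 1)) = 0 ∧
        ∀ x : Δ.RedHomologyAt (j + 1), x = 0)) := by
  rw [Δ.forall_winnable_iff, Δ.forall_crit_eq_zero_iff, Δ.ker_bdry_le_range_Lap_iff,
    Δ.forall_redHomologyAt_eq_zero_iff, Δ.isSpanningForest_Faces_iff]
  refine ⟨Iff.rfl, and_congr_right fun _ => ⟨fun h => ⟨?_, h⟩, fun h => h.2⟩⟩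
  have : Subsingleton (Δ.RedHomologyAt (j + 1)) :=
    subsingleton_of_forall_eq 0 ((Δ.forall_redHomologyAt_eq_zero_iff j).2 h)
  exact Module.finrank_zero_of_subsingleton
end

section
/- With the standard orientation on Δ, the only effective cycle is zero: for every i ≥ 0, if σ ∈ C_i(Δ) is effective and ∂_i(σ) = 0 (where ∂_0 is the reduced boundary map into C_{−1}(Δ) ≅ ℤ), then σ = 0. -/
open Finset Matrix

theorem SComplex.bcoef_insert {n : ℕ} {g : Finset (Fin n)} {v : Fin n} (hv : v ∉ g) :
    SComplex.bcoef (insert v g) g =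
      (-1 : ℤ) ^ ((insert v g).filter (fun x => x < v)).card := by
  have hsdiff : insert v g \ g = {v} := by
    ext x
    simp only [mem_sdiff, mem_insert, mem_singleton]
    grind
  rw [SComplex.bcoef, if_pos ⟨subset_insert v g, card_insert_of_notMem hv⟩, hsdiff,
    sum_singleton]

theorem SComplex.bcoef_insert_of_le {n : ℕ} {g : Finset (Fin n)} {v : Fin n} (hv : v ∉ g)
    (hle : ∀ x ∈ insert v g, v ≤ x) : SComplex.bcoef (insert v g) g = 1 := by
  rw [SComplex.bcoef_insert hv, filter_eq_empty_iff.2 fun x hx => not_lt.2 (hle x hx)]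
  simp

/-- A nonempty family of nonempty faces of equal size has a member with a codimension-one
subface `g` that occurs with coefficient `1` in every member of the family containing it. -/
theorem SComplex.exists_bcoef_eq_one {n : ℕ} (S : Finset (Finset (Fin n))) (hS : S.Nonempty)
    {k : ℕ} (hcard : ∀ f ∈ S, f.card = k + 1) :
    ∃ f ∈ S, ∃ g ⊆ f, g.card = k ∧ SComplex.bcoef f g = 1 ∧
      ∀ f' ∈ S, 0 ≤ SComplex.bcoef f' g := by
  have hP : (S.sigma fun f => f).Nonempty := by
    obtain ⟨f, hf⟩ := hS
    obtain ⟨v, hv⟩ := card_pos.1 (by rw [hcard f hf]; omega : 0 < f.card)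
    exact ⟨⟨f, v⟩, mem_sigma.2 ⟨hf, hv⟩⟩
  obtain ⟨⟨f, v⟩, hfv, hmax⟩ :=
    exists_max_image _ (fun p : (_ : Finset (Fin n)) × Fin n => ∑ x ∈ p.1.erase p.2, (x : ℕ)) hP
  obtain ⟨hf, hv⟩ := mem_sigma.1 hfv
  dsimp only at hf hv hmax
  have key : ∀ u ∉ f.erase v, insert u (f.erase v) ∈ S →
      SComplex.bcoef (insert u (f.erase v)) (f.erase v) = 1 := by
    intro u hu hmem
    refine SComplex.bcoef_insert_of_le hu fun x hx => ?_
    have h := hmax ⟨_, x⟩ (mem_sigma.2 ⟨hmem, hx⟩)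
    dsimp only at h
    have h₁ := sum_erase_add (insert u (f.erase v)) (fun y : Fin n => (y : ℕ)) hx
    rw [sum_insert hu] at h₁
    exact Fin.le_def.2 (by omega)
  have hgcard : (f.erase v).card = k := by rw [card_erase_of_mem hv, hcard f hf]; rfl
  refine ⟨f, hf, f.erase v, erase_subset v f, hgcard, ?_, fun f' hf' => ?_⟩
  · simpa [insert_erase hv, hf] using key v (notMem_erase v f)
  · by_cases hsub : f.erase v ⊆ f'
    · obtain ⟨u, hu⟩ := card_eq_one.1 (by
        rw [card_sdiff_of_subset hsub, hcard f' hf', hgcard]; omega :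
          (f' \ f.erase v).card = 1)
      have hins : insert u (f.erase v) = f' := by
        rw [insert_eq, ← hu, sdiff_union_of_subset hsub]
      have hu' : u ∉ f.erase v := (mem_sdiff.1 (hu ▸ mem_singleton_self u)).2
      rw [← hins, key u hu' (hins ▸ hf')]
      exact zero_le_one
    · rw [SComplex.bcoef, if_neg fun h => hsub h.1]

/-- With the standard orientation on `Δ`, the only effective cycle
is zero: for every `i ≥ 0`, if an `i`-chain `σ` is effective and `∂_i(σ) = 0` (with
`∂_0` the reduced boundary map into `C_{-1}(Δ) ≅ ℤ`), then `σ = 0`. -/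
theorem effective_cycle_eq_zero {n : ℕ} (Δ : SComplex n) :
    ∀ (i : ℕ) (σ : Δ.Chain (i + 1)), Δ.Effective σ → Δ.bdry i σ = 0 → σ = 0 := by
  intro i σ hσ hcycle
  by_contra hne
  obtain ⟨f₀, hf₀⟩ := Function.ne_iff.1 hne
  obtain ⟨f, hf, g, hgf, hgcard, hone, hnonneg⟩ := SComplex.exists_bcoef_eq_one
    ((univ.filter fun f => σ f ≠ 0).map (Function.Embedding.subtype _))
    ⟨f₀, mem_map.2 ⟨f₀, by simpa using hf₀, rfl⟩⟩ (k := i) (by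
      intro f hf
      obtain ⟨a, -, rfl⟩ := mem_map.1 hf
      exact (mem_filter.1 a.2).2)
  obtain ⟨a, ha, rfl⟩ := mem_map.1 hf
  have hg : g ∈ Δ.Faces i :=
    mem_filter.2 ⟨Δ.down_closed _ (mem_filter.1 a.2).1 g hgf, hgcard⟩
  have hzero : ∑ b, SComplex.bcoef b.1 g * σ b = 0 := congrFun hcycle ⟨g, hg⟩
  have hterm : ∀ b ∈ univ, 0 ≤ SComplex.bcoef b.1 g * σ b := by
    intro b _
    by_cases hb : σ b = 0
    · simp [hb]
    · exact mul_nonneg (hnonneg b.1 (mem_map.2 ⟨b, by simpa using hb, rfl⟩)) (hσ b)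
  have h := (sum_eq_zero_iff_of_nonneg hterm).1 hzero a (mem_univ a)
  change SComplex.bcoef a.1 g = 1 at hone
  rw [hone, one_mul] at h
  exact (mem_filter.1 ha).2 h
end
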